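/- Let V be a finite-dimensional vector space over F₂ with a nondegenerate symmetric bilinear form b such that b(x, x) ≠ 0 for some x ∈ V. Then V admits an orthonormal basis for b: a basis (e₁, …, e_n) with b(e_j, e_k) = 1 if j = k and 0 otherwise. -/

import Mathlib

theorem zmod2_cases (a : ZMod 2) : a = 0 ∨ a = 1 := by
  revert a; decide

theorem good_vector (V : Type) [AddCommGroup V] [Module (ZMod 2) V]
    (b : V →ₗ[ZMod 2] V →ₗ[ZMod 2] ZMod 2)
    (hsymm : ∀ x y : V, b x y = b y x)
    (hnd : ∀ x : V, (∀ y : V, b x y = 0) → x = 0)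
    (hx : ∃ x : V, b x x = 1) :
    ∃ x : V, b x x = 1 ∧ ((∀ u, b x u = 0 → u = 0) ∨ ∃ y, b x y = 0 ∧ b y y = 1) := by
  obtain ⟨x, hx⟩ := hx
  by_cases h : ∃ y, b x y = 0 ∧ b y y = 1
  · exact ⟨x, hx, Or.inr h⟩
  by_cases h2 : ∀ u, b x u = 0 → u = 0
  · exact ⟨x, hx, Or.inl h2⟩
  push Not at h h2
  have alt : ∀ y, b x y = 0 → b y y = 0 := fun y hy =>
    (zmod2_cases _).resolve_right (h y hy)
  obtain ⟨u, hu, hu0⟩ := h2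
  have : ∃ y, b u y ≠ 0 := by
    by_contra! hc
    exact hu0 (hnd u hc)
  obtain ⟨y, hy⟩ := this
  have hy : b u y = 1 := (zmod2_cases _).resolve_left hy
  have hux : b u x = 0 := by rw [hsymm, hu]
  set w := y - b x y • x with hw
  have hxw : b x w = 0 := by simp [hw, hx]
  have huw : b u w = 1 := by simp [hw, hux, hy]
  have hwx : b w x = 0 := by rw [hsymm, hxw]
  have h11 : (1 : ZMod 2) + 1 = 0 := by decide
  refine ⟨x + u, ?_, Or.inr ⟨x + w, ?_, ?_⟩⟩
  · simp [hx, hu, hux, alt u hu]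
  · simp [hx, hux, hxw, huw, h11]
  · simp [hx, hxw, hwx, alt w hxw]

theorem ortho_family (n : ℕ) : ∀ (V : Type) [AddCommGroup V] [Module (ZMod 2) V]
    [FiniteDimensional (ZMod 2) V]
    (b : V →ₗ[ZMod 2] V →ₗ[ZMod 2] ZMod 2)
    (_ : ∀ x y : V, b x y = b y x)
    (_ : ∀ x : V, (∀ y : V, b x y = 0) → x = 0)
    (_ : (∀ x : V, x = 0) ∨ ∃ x : V, b x x = 1) (_ : Module.finrank (ZMod 2) V = n),
    ∃ v : Fin n → V, ∀ j k, b (v j) (v k) = if j = k then 1 else 0 := by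
  induction n with
  | zero => intro V _ _ _ b _ _ _ _; exact ⟨fun i => i.elim0, fun i => i.elim0⟩
  | succ n ih =>
    intro V _ _ _ b hsymm hnd hx hn
    have hx : ∃ x : V, b x x = 1 := by
      refine hx.resolve_left fun h0 => ?_
      have : Subsingleton V := ⟨fun a c => by rw [h0 a, h0 c]⟩
      rw [Module.finrank_zero_of_subsingleton] at hn
      omega
    obtain ⟨x, hx, hg⟩ := good_vector V b hsymm hnd hx
    have hfr : Module.finrank (ZMod 2) (LinearMap.ker (b x)) = n := by
      have h1 := LinearMap.finrank_range_add_finrank_ker (b x)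
      have h2 : LinearMap.range (b x) = ⊤ := by
        rw [LinearMap.range_eq_top]
        intro c
        exact ⟨c • x, by simp [hx]⟩
      rw [h2, finrank_top, Module.finrank_self, hn] at h1
      omega
    obtain ⟨v, hv⟩ := ih (LinearMap.ker (b x))
      (b.domRestrict₁₂ (LinearMap.ker (b x)) (LinearMap.ker (b x)))
      (fun y z => hsymm y z)
      (by
        rintro ⟨z, hz⟩ h
        have hz' : b x z = 0 := hz
        have : z = 0 := by
          apply hnd
          intro y
          have : b z (y - b x y • x) = 0 := h ⟨y - b x y • x, by simp [hx]⟩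
          simpa [hsymm z x, hz'] using this
        simpa using this)
      (by
        rcases hg with hg | ⟨y, hy, hyy⟩
        · left
          rintro ⟨z, hz⟩
          have := hg z hz
          simpa using this
        · right
          exact ⟨⟨y, hy⟩, hyy⟩) hfr
    have hv' : ∀ j k, b (v j) (v k) = if j = k then 1 else 0 := fun j k => by
      exact hv j k
    have hxv : ∀ j, b x (v j) = 0 := fun j => (v j).2
    refine ⟨Fin.cons x (fun i => (v i : V)), fun j k => ?_⟩
    refine Fin.cases ?_ (fun j => ?_) j <;> refine Fin.cases ?_ (fun k => ?_) k
    · simp [hx]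
    · simp [hxv, (Fin.succ_ne_zero k).symm]
    · simp [hsymm _ x, hxv]
    · simp [hv']

/-- Let `V` be a finite-dimensional vector space over `F₂` with a
nondegenerate symmetric bilinear form `b` such that `b(x, x) ≠ 0` for some `x ∈ V`.  Then `V`
admits an orthonormal basis for `b`: a basis `(e₁, …, e_n)` with `b(e_j, e_k) = 1` if `j = k`
and `0` otherwise. -/
theorem statement15 (V : Type) [AddCommGroup V] [Module (ZMod 2) V]
    [FiniteDimensional (ZMod 2) V]
    (b : V →ₗ[ZMod 2] V →ₗ[ZMod 2] ZMod 2)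
    (hsymm : ∀ x y : V, b x y = b y x)
    (hnd : ∀ x : V, (∀ y : V, b x y = 0) → x = 0)
    (hx : ∃ x : V, b x x ≠ 0) :
    ∃ v : Module.Basis (Fin (Module.finrank (ZMod 2) V)) (ZMod 2) V,
      ∀ j k, b (v j) (v k) = if j = k then 1 else 0 := by
  obtain ⟨v, hv⟩ := ortho_family _ V b hsymm hnd
    (Or.inr (hx.imp fun x h => (zmod2_cases _).resolve_left h)) rfl
  have hli : LinearIndependent (ZMod 2) v := by
    rw [Fintype.linearIndependent_iff]
    intro g hg i
    have := congrArg (b (v i)) hg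
    simpa [hv] using this
  refine ⟨basisOfLinearIndependentOfCardEqFinrank' v hli (by simp), ?_⟩
  intro j k
  simpa using hv j k
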